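/- In the multi-client local-momentum setup, if η < 1/L and E < (1/4)·min(1/(ηL), 1/(η²L²) − 1/(ηL)), then Σ_{τ=0}^{E−1} E[‖v̄_{k,τ} − ∇f(w̄_{k,τ})‖²] ≤ (16η²L²E²(αE+4)/n²)·Σ_{i∈[n]} ‖∇f_i(w_k)‖². -/

import Mathlib

open MeasureTheory Finset

section helpers

lemma aux_update_mp {ι : Type*} [Fintype ι] [DecidableEq ι] {X : ι → Type*}
    [∀ i, MeasurableSpace (X i)] (μ : ∀ i, Measure (X i)) [∀ i, IsProbabilityMeasure (μ i)]
    (i : ι) :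
    MeasurePreserving (fun p : (∀ j, X j) × X i => Function.update p.1 i p.2)
      ((Measure.pi μ).prod (μ i)) (Measure.pi μ) := by
  have hm : Measurable (fun p : (∀ j, X j) × X i => Function.update p.1 i p.2) := by
    rw [measurable_pi_iff]
    intro j
    by_cases h : j = i
    · subst h; simpa using measurable_snd
    · simp only [Function.update_of_ne h]
      exact (measurable_pi_apply j).comp measurable_fst
  refine ⟨hm, ?_⟩
  symm
  apply Measure.pi_eq
  intro s hs
  rw [Measure.map_apply hm (MeasurableSet.univ_pi hs)]
  have : (fun p : (∀ j, X j) × X i => Function.update p.1 i p.2) ⁻¹' (Set.univ.pi s)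
      = (Set.univ.pi (Function.update s i Set.univ)) ×ˢ (s i) := by
    ext ⟨ω, x⟩
    simp only [Set.mem_preimage, Set.mem_pi, Set.mem_univ, true_implies, Set.mem_prod]
    constructor
    · intro h
      refine ⟨fun j => ?_, by simpa using h i⟩
      by_cases hj : j = i
      · subst hj; simp
      · simpa [Function.update_of_ne hj] using h j
    · rintro ⟨h1, h2⟩ j
      by_cases hj : j = i
      · subst hj; simpa using h2
      · simpa [Function.update_of_ne hj] using h1 j
  rw [this, Measure.prod_prod, Measure.pi_pi, ← Finset.mul_prod_erase _ _ (Finset.mem_univ i),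
    ← Finset.mul_prod_erase Finset.univ (fun j => μ j (s j)) (Finset.mem_univ i)]
  rw [Function.update_self, measure_univ, one_mul, mul_comm]
  congr 1
  apply Finset.prod_congr rfl
  intro j hj
  rw [Function.update_of_ne (Finset.ne_of_mem_erase hj)]

lemma aux_integral_update {ι : Type*} [Fintype ι] [DecidableEq ι] {X : ι → Type*}
    [∀ i, MeasurableSpace (X i)] (μ : ∀ i, Measure (X i)) [∀ i, IsProbabilityMeasure (μ i)]
    (i : ι) (F : (∀ j, X j) → ℝ) (hF : Integrable F (Measure.pi μ)) :
    ∫ ω, F ω ∂(Measure.pi μ)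
      = ∫ ω, ∫ x, F (Function.update ω i x) ∂(μ i) ∂(Measure.pi μ) := by
  have mp := aux_update_mp μ i
  rw [← mp.map_eq, integral_map mp.measurable.aemeasurable (by rw [mp.map_eq]; exact hF.1),
    mp.map_eq, integral_prod]
  exact mp.integrable_comp_of_integrable hF

lemma aux_resample {Bt : Type*} [MeasurableSpace Bt] (μB : Measure Bt) [IsProbabilityMeasure μB]
    {n E : ℕ} (i : Fin n) (t : Fin E) (F : (Fin n → Fin E → Bt) → ℝ) (hF : Measurable F)
    (C : ℝ) (hC : ∀ ω, ‖F ω‖ ≤ C)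
    (h0 : ∀ ω, ∫ b, F (Function.update ω i (Function.update (ω i) t b)) ∂μB = 0) :
    ∫ ω, F ω ∂(Measure.pi fun _ : Fin n => Measure.pi fun _ : Fin E => μB) = 0 := by
  rw [aux_integral_update _ i F (Integrable.of_bound hF.aestronglyMeasurable C (.of_forall hC))]
  apply integral_eq_zero_of_ae
  refine .of_forall fun ω => ?_
  have hm : Measurable fun x => F (Function.update ω i x) := hF.comp (measurable_update ω)
  change ∫ x, F (Function.update ω i x) ∂(Measure.pi fun _ : Fin E => μB) = 0
  rw [aux_integral_update (fun _ : Fin E => μB) t (fun x => F (Function.update ω i x))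
    (Integrable.of_bound hm.aestronglyMeasurable C (.of_forall fun _ => hC _))]
  apply integral_eq_zero_of_ae
  refine .of_forall fun x => ?_
  have := h0 (Function.update ω i x)
  simpa using this

lemma aux_orth {Ω V κ : Type*} [MeasurableSpace Ω] (P : Measure Ω) [IsProbabilityMeasure P]
    [NormedAddCommGroup V] [InnerProductSpace ℝ V] [MeasurableSpace V] [BorelSpace V]
    [SecondCountableTopology V]
    (S : Finset κ) (X : κ → Ω → V) (C : κ → ℝ)
    (hm : ∀ p ∈ S, Measurable (X p)) (hC : ∀ p ∈ S, ∀ ω, ‖X p ω‖ ≤ C p)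
    (ho : ∀ p ∈ S, ∀ q ∈ S, p ≠ q → ∫ ω, inner ℝ (X p ω) (X q ω) ∂P = 0) :
    ∫ ω, ‖∑ p ∈ S, X p ω‖ ^ 2 ∂P ≤ ∑ p ∈ S, C p ^ 2 := by
  have hint : ∀ p ∈ S, ∀ q ∈ S, Integrable (fun ω => (inner ℝ (X p ω) (X q ω) : ℝ)) P := by
    intro p hp q hq
    refine Integrable.of_bound ((hm p hp).inner (hm q hq)).aestronglyMeasurable (C p * C q)
      (.of_forall fun ω => (norm_inner_le_norm _ _).trans ?_)
    exact mul_le_mul (hC p hp ω) (hC q hq ω) (norm_nonneg _) ((norm_nonneg _).trans (hC p hp ω))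
  have e : ∀ ω, ‖∑ p ∈ S, X p ω‖ ^ 2 = ∑ p ∈ S, ∑ q ∈ S, (inner ℝ (X p ω) (X q ω) : ℝ) := by
    intro ω
    rw [← real_inner_self_eq_norm_sq, sum_inner]
    simp_rw [inner_sum]
  simp_rw [e]
  rw [integral_finsetSum _ (fun p hp => integrable_finsetSum _ (fun q hq => hint p hp q hq))]
  apply Finset.sum_le_sum
  intro p hp
  rw [integral_finsetSum _ (fun q hq => hint p hp q hq),
    Finset.sum_eq_single_of_mem p hp (fun q hq hne => ho p hp q hq hne.symm)]
  calc ∫ ω, (inner ℝ (X p ω) (X p ω) : ℝ) ∂P ≤ ∫ ω, C p ^ 2 ∂P := by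
        apply integral_mono (hint p hp p hp) (integrable_const _)
        intro ω
        change (inner ℝ (X p ω) (X p ω) : ℝ) ≤ C p ^ 2
        rw [real_inner_self_eq_norm_sq]
        exact pow_le_pow_left₀ (norm_nonneg _) (hC p hp ω) 2
    _ = C p ^ 2 := by simp

lemma aux_mean {V : Type*} [NormedAddCommGroup V] [InnerProductSpace ℝ V] (n : ℕ) (hn : 1 ≤ n)
    (x : Fin n → V) (c : V) :
    ∑ i, ‖x i - (n : ℝ)⁻¹ • ∑ j, x j‖ ^ 2 ≤ ∑ i, ‖x i - c‖ ^ 2 := by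
  set m := (n : ℝ)⁻¹ • ∑ j, x j with hmdef
  have hn0 : (n : ℝ) ≠ 0 := by positivity
  have hs : ∑ i, (x i - m) = 0 := by
    rw [Finset.sum_sub_distrib, Finset.sum_const, Finset.card_univ, Fintype.card_fin,
      ← Nat.cast_smul_eq_nsmul ℝ, hmdef, smul_smul, mul_inv_cancel₀ hn0, one_smul, sub_self]
  have e : ∀ i, ‖x i - c‖ ^ 2
      = ‖x i - m‖ ^ 2 + 2 * inner ℝ (x i - m) (m - c) + ‖m - c‖ ^ 2 := by
    intro i
    rw [← norm_add_sq_real]; congr 2; abel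
  simp_rw [e]
  rw [Finset.sum_add_distrib, Finset.sum_add_distrib, ← Finset.mul_sum, ← sum_inner, hs,
    inner_zero_left]
  have : 0 ≤ ∑ i : Fin n, ‖m - c‖ ^ 2 := by positivity
  linarith

lemma aux_pow (x : ℝ) (hx : 0 ≤ x) (E τ : ℕ) (h : τ ≤ E) (hE : (E : ℝ) * x ≤ 1 / 4) :
    (1 + x) ^ τ ≤ 2 := by
  have h1 : (τ : ℝ) * x ≤ 1 / 4 :=
    (mul_le_mul_of_nonneg_right (by exact_mod_cast h) hx).trans hE
  calc (1 + x) ^ τ ≤ (Real.exp x) ^ τ := by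
        apply pow_le_pow_left₀ (by positivity)
        linarith [Real.add_one_le_exp x]
    _ = Real.exp (τ * x) := by rw [Real.exp_nat_mul]
    _ ≤ Real.exp (Real.log 2) := by
        apply Real.exp_le_exp.2
        linarith [Real.log_two_gt_d9]
    _ = 2 := Real.exp_log (by norm_num)

end helpers

lemma aux_core
    {d : ℕ} {Bt : Type*} [MeasurableSpace Bt]
    (μB : Measure Bt) [IsProbabilityMeasure μB]
    (n E : ℕ) (hn : 1 ≤ n) (η L α : ℝ)
    (hη : 0 < η) (hL : 0 < L) (hα : 0 ≤ α)
    (g : Fin n → EuclideanSpace ℝ (Fin d) → EuclideanSpace ℝ (Fin d))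
    (hsmooth : ∀ i x y, ‖g i x - g i y‖ ≤ L * ‖x - y‖)
    (G : Fin n → EuclideanSpace ℝ (Fin d) → Bt → EuclideanSpace ℝ (Fin d))
    (hGlip : ∀ i b x y, ‖G i x b - G i y b‖ ≤ L * ‖x - y‖)
    (hGint : ∀ i x, Integrable (G i x) μB)
    (hGm : ∀ i x, Measurable (G i x))
    (hGunb : ∀ i x, ∫ b, G i x b ∂μB = g i x)
    (wk : EuclideanSpace ℝ (Fin d))
    (w v : Fin n → ℕ → (Fin n → Fin E → Bt) → EuclideanSpace ℝ (Fin d))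
    (hw0 : ∀ i ω, w i 0 ω = wk)
    (hv0 : ∀ i ω, v i 0 ω = g i wk)
    (hv : ∀ i τ (h2 : τ + 1 < E), ∀ ω,
      v i (τ + 1) ω = G i (w i (τ + 1) ω) (ω i ⟨τ + 1, h2⟩) + v i τ ω
        - G i (w i τ ω) (ω i ⟨τ + 1, h2⟩))
    (hw : ∀ i τ, τ < E → ∀ ω, w i (τ + 1) ω = w i τ ω - η • v i τ ω)
    (hhet : ∀ τ, 1 ≤ τ → τ ≤ E →
      ∫ ω, ‖∑ i, (g i (w i τ ω) - g i ((n : ℝ)⁻¹ • ∑ j, w j τ ω))‖ ^ 2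
          ∂(Measure.pi fun _ : Fin n => Measure.pi fun _ : Fin E => μB)
        ≤ α * ∑ i, ∫ ω, ‖g i (w i τ ω) - g i ((n : ℝ)⁻¹ • ∑ j, w j τ ω)‖ ^ 2
          ∂(Measure.pi fun _ : Fin n => Measure.pi fun _ : Fin E => μB))
    (hE4 : (E : ℝ) * (η * L) ≤ 1 / 4) :
    ∑ τ ∈ Finset.range E,
        ∫ ω, ‖(n : ℝ)⁻¹ • ∑ i, v i τ ω
            - (n : ℝ)⁻¹ • ∑ i, g i ((n : ℝ)⁻¹ • ∑ i, w i τ ω)‖ ^ 2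
          ∂(Measure.pi fun _ : Fin n => Measure.pi fun _ : Fin E => μB)
      ≤ (16 * η ^ 2 * L ^ 2 * (E : ℝ) ^ 2 * (α * E + 4) / (n : ℝ) ^ 2) *
          ∑ i, ‖g i wk‖ ^ 2 := by
  set P := (Measure.pi fun _ : Fin n => Measure.pi fun _ : Fin E => μB) with hP
  have hηL0 : 0 ≤ η * L := by positivity
  -- continuity
  have hcont : ∀ (h : EuclideanSpace ℝ (Fin d) → EuclideanSpace ℝ (Fin d)),
      (∀ x y, ‖h x - h y‖ ≤ L * ‖x - y‖) → Continuous h := by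
    intro h hh
    apply LipschitzWith.continuous (K := ⟨L, hL.le⟩)
    apply LipschitzWith.of_dist_le_mul
    intro x y
    rw [dist_eq_norm, dist_eq_norm]
    exact hh x y
  have hgm : ∀ i, Measurable (g i) := fun i => (hcont _ (hsmooth i)).measurable
  have hGm2 : ∀ i, Measurable (Function.uncurry (G i)) := fun i =>
    measurable_uncurry_of_continuous_of_measurable (u := G i)
      (fun b => hcont _ (hGlip i b)) (fun x => hGm i x)
  -- bounds
  have hstep : ∀ i τ, τ < E → ∀ ω, ‖w i (τ + 1) ω - w i τ ω‖ = η * ‖v i τ ω‖ := by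
    intro i τ h ω
    rw [hw i τ h ω, sub_sub_cancel_left, norm_neg, norm_smul, Real.norm_of_nonneg hη.le]
  have hvb0 : ∀ i τ, τ < E → ∀ ω, ‖v i τ ω‖ ≤ (1 + η * L) ^ τ * ‖g i wk‖ := by
    intro i τ
    induction τ with
    | zero => intro _ ω; simp [hv0]
    | succ τ ih =>
      intro h ω
      have h' : τ < E := by omega
      have h1 := hGlip i (ω i ⟨τ + 1, h⟩) (w i (τ + 1) ω) (w i τ ω)
      rw [hstep i τ h' ω] at h1
      have h2 := ih h' ω
      have h3 : v i (τ + 1) ω = v i τ ω + (G i (w i (τ + 1) ω) (ω i ⟨τ + 1, h⟩)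
          - G i (w i τ ω) (ω i ⟨τ + 1, h⟩)) := by
        rw [hv i τ h ω]; abel
      rw [h3]
      calc _ ≤ ‖v i τ ω‖ + L * (η * ‖v i τ ω‖) := (norm_add_le _ _).trans (by gcongr)
        _ = (1 + η * L) * ‖v i τ ω‖ := by ring
        _ ≤ (1 + η * L) * ((1 + η * L) ^ τ * ‖g i wk‖) := by gcongr
        _ = _ := by ring
  have hvb : ∀ i τ, τ < E → ∀ ω, ‖v i τ ω‖ ≤ 2 * ‖g i wk‖ := by
    intro i τ h ω
    refine (hvb0 i τ h ω).trans ?_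
    gcongr
    exact aux_pow _ hηL0 E τ h.le hE4
  have hwb : ∀ i τ, τ ≤ E → ∀ ω, ‖w i τ ω - wk‖ ≤ τ * (2 * η * ‖g i wk‖) := by
    intro i τ
    induction τ with
    | zero => intro _ ω; simp [hw0]
    | succ τ ih =>
      intro h ω
      have h1 := hstep i τ (by omega) ω
      have h2 := ih (by omega) ω
      have h3 := hvb i τ (by omega) ω
      have h4 : η * ‖v i τ ω‖ ≤ η * (2 * ‖g i wk‖) := by gcongr
      have h5 : w i (τ + 1) ω - wk = (w i (τ + 1) ω - w i τ ω) + (w i τ ω - wk) := by abel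
      rw [h5]
      refine (norm_add_le _ _).trans ?_
      push_cast
      rw [h1]; linarith
  -- measurability
  have hmeas : ∀ i τ, τ < E → Measurable (w i τ) ∧ Measurable (v i τ) := by
    intro i τ
    induction τ with
    | zero =>
      intro _
      refine ⟨?_, ?_⟩
      · rw [show w i 0 = fun _ => wk from funext (hw0 i)]; exact measurable_const
      · rw [show v i 0 = fun _ => g i wk from funext (hv0 i)]; exact measurable_const
    | succ τ ih =>
      intro h
      obtain ⟨h1, h2⟩ := ih (by omega)
      have hb : Measurable fun ω : Fin n → Fin E → Bt => ω i ⟨τ + 1, h⟩ :=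
        (measurable_pi_apply _).comp (measurable_pi_apply i)
      have h3 : Measurable (w i (τ + 1)) := by
        rw [show w i (τ + 1) = fun ω => w i τ ω - η • v i τ ω from
          funext (hw i τ (by omega))]
        exact h1.sub (h2.const_smul η)
      refine ⟨h3, ?_⟩
      rw [funext (hv i τ h)]
      exact (((hGm2 i).comp (h3.prodMk hb)).add h2).sub ((hGm2 i).comp (h1.prodMk hb))
  -- independence of coordinates
  have hdep : ∀ i τ, τ < E → ∀ (j : Fin n) (t : Fin E) (b : Bt) (ω : Fin n → Fin E → Bt),
      ((i ≠ j ∨ τ ≤ t.1) →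
        w i τ (Function.update ω j (Function.update (ω j) t b)) = w i τ ω) ∧
      ((i ≠ j ∨ τ < t.1) →
        v i τ (Function.update ω j (Function.update (ω j) t b)) = v i τ ω) := by
    intro i τ
    induction τ with
    | zero => intro _ j t b ω; simp [hw0, hv0]
    | succ τ ih =>
      intro h j t b ω
      obtain ⟨h1, h2⟩ := ih (by omega) j t b ω
      have h3 : (i ≠ j ∨ τ + 1 ≤ t.1) →
          w i (τ + 1) (Function.update ω j (Function.update (ω j) t b)) = w i (τ + 1) ω := by
        intro hc
        rw [hw i τ (by omega), hw i τ (by omega), h1 (hc.imp id (by omega)),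
          h2 (hc.imp id (by omega))]
      refine ⟨h3, fun hc => ?_⟩
      have hb : (Function.update ω j (Function.update (ω j) t b)) i ⟨τ + 1, h⟩
          = ω i ⟨τ + 1, h⟩ := by
        by_cases hij : i = j
        · subst hij
          rw [Function.update_self, Function.update_of_ne]
          intro he
          have := congrArg Fin.val he
          simp at this
          rcases hc with hc | hc
          · exact hc rfl
          · omega
        · rw [Function.update_of_ne hij]
      rw [hv i τ h, hv i τ h, hb, h3 (hc.imp id (by omega)), h1 (hc.imp id (by omega)),
        h2 (hc.imp id (by omega))]
  -- martingale increments
  let ξ : Fin n × ℕ → (Fin n → Fin E → Bt) → EuclideanSpace ℝ (Fin d) := fun p ω =>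
    (v p.1 (p.2 + 1) ω - g p.1 (w p.1 (p.2 + 1) ω)) - (v p.1 p.2 ω - g p.1 (w p.1 p.2 ω))
  have hξ : ∀ i t (h : t + 1 < E) ω, ξ (i, t) ω =
      (G i (w i (t + 1) ω) (ω i ⟨t + 1, h⟩) - G i (w i t ω) (ω i ⟨t + 1, h⟩))
        - (g i (w i (t + 1) ω) - g i (w i t ω)) := by
    intro i t h ω
    simp only [ξ]
    rw [hv i t h ω]; abel
  have hξm : ∀ i t, t + 1 < E → Measurable (ξ (i, t)) := by
    intro i t h
    obtain ⟨a, b⟩ := hmeas i (t + 1) h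
    obtain ⟨a', b'⟩ := hmeas i t (by omega)
    exact (b.sub ((hgm i).comp a)).sub (b'.sub ((hgm i).comp a'))
  have hξb : ∀ i t, t + 1 < E → ∀ ω, ‖ξ (i, t) ω‖ ≤ 4 * (η * L) * ‖g i wk‖ := by
    intro i t h ω
    rw [hξ i t h ω]
    have h1 := hGlip i (ω i ⟨t + 1, h⟩) (w i (t + 1) ω) (w i t ω)
    have h2 := hsmooth i (w i (t + 1) ω) (w i t ω)
    rw [hstep i t (by omega) ω] at h1 h2
    have h3 : L * (η * ‖v i t ω‖) ≤ L * (η * (2 * ‖g i wk‖)) := by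
      gcongr; exact hvb i t (by omega) ω
    refine (norm_sub_le _ _).trans ?_
    linarith
  have horth1 : ∀ i t j s, t + 1 < E → s + 1 < E → (j ≠ i ∨ s < t) →
      ∫ ω, inner ℝ (ξ (i, t) ω) (ξ (j, s) ω) ∂P = 0 := by
    intro i t j s ht hs hc
    refine aux_resample μB i ⟨t + 1, ht⟩ _ ((hξm i t ht).inner (hξm j s hs))
      ((4 * (η * L) * ‖g i wk‖) * (4 * (η * L) * ‖g j wk‖)) ?_ ?_
    · intro ω
      refine (norm_inner_le_norm _ _).trans ?_
      exact mul_le_mul (hξb i t ht ω) (hξb j s hs ω) (norm_nonneg _) (by positivity)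
    · intro ω
      have e1 : ∀ b, ξ (j, s) (Function.update ω i (Function.update (ω i) ⟨t + 1, ht⟩ b))
          = ξ (j, s) ω := by
        intro b
        obtain ⟨a1, a2⟩ := hdep j (s + 1) hs i ⟨t + 1, ht⟩ b ω
        obtain ⟨a3, a4⟩ := hdep j s (by omega) i ⟨t + 1, ht⟩ b ω
        simp only [ξ]
        rw [a1 (hc.imp id (fun h => by simp; omega)), a2 (hc.imp id (fun h => by simp; omega)),
          a3 (hc.imp id (fun h => by simp; omega)), a4 (hc.imp id (fun h => by simp; omega))]
      have e2 : ∀ b, ξ (i, t) (Function.update ω i (Function.update (ω i) ⟨t + 1, ht⟩ b))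
          = (G i (w i (t + 1) ω) b - G i (w i t ω) b)
            - (g i (w i (t + 1) ω) - g i (w i t ω)) := by
        intro b
        obtain ⟨a1, -⟩ := hdep i (t + 1) ht i ⟨t + 1, ht⟩ b ω
        obtain ⟨a3, -⟩ := hdep i t (by omega) i ⟨t + 1, ht⟩ b ω
        rw [hξ i t ht, a1 (Or.inr (by simp)), a3 (Or.inr (by simp))]
        simp
      simp_rw [e1, e2]
      have hi : Integrable (fun b => (G i (w i (t + 1) ω) b - G i (w i t ω) b)
            - (g i (w i (t + 1) ω) - g i (w i t ω))) μB :=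
        ((hGint i _).sub (hGint i _)).sub (integrable_const _)
      simp_rw [real_inner_comm (ξ (j, s) ω)]
      rw [integral_inner hi]
      have hi2 : Integrable (fun b => G i (w i (t + 1) ω) b - G i (w i t ω) b) μB :=
        (hGint i _).sub (hGint i _)
      rw [integral_sub hi2 (integrable_const _),
        integral_sub (hGint i _) (hGint i _), hGunb, hGunb]
      simp
  have hmart : ∀ τ, τ < E →
      ∫ ω, ‖∑ i, (v i τ ω - g i (w i τ ω))‖ ^ 2 ∂P
        ≤ 16 * E * (η * L) ^ 2 * ∑ i, ‖g i wk‖ ^ 2 := by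
    intro τ hτ
    have e : ∀ ω, ∑ i, (v i τ ω - g i (w i τ ω)) = ∑ p ∈ univ ×ˢ range τ, ξ p ω := by
      intro ω
      rw [Finset.sum_product]
      apply Finset.sum_congr rfl
      intro i _
      simp only [ξ]
      rw [Finset.sum_range_sub (fun t => v i t ω - g i (w i t ω))]
      simp [hv0, hw0]
    simp_rw [e]
    refine (aux_orth P (univ ×ˢ range τ) ξ (fun p => 4 * (η * L) * ‖g p.1 wk‖) ?_ ?_ ?_).trans ?_
    · rintro ⟨i, t⟩ hp
      simp at hp
      exact hξm i t (by omega)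
    · rintro ⟨i, t⟩ hp
      simp at hp
      exact hξb i t (by omega)
    · rintro ⟨i, t⟩ hp ⟨j, s⟩ hq hne
      simp at hp hq
      by_cases hij : j ≠ i
      · exact horth1 i t j s (by omega) (by omega) (Or.inl hij)
      · push Not at hij
        subst hij
        rcases lt_trichotomy s t with h | h | h
        · exact horth1 _ t _ s (by omega) (by omega) (Or.inr h)
        · subst h; exact absurd rfl hne
        · simp_rw [real_inner_comm (ξ (j, s) _)]
          exact horth1 _ s _ t (by omega) (by omega) (Or.inr h)
    · rw [Finset.sum_product, Finset.mul_sum]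
      apply Finset.sum_le_sum
      intro i _
      simp only [Finset.sum_const, Finset.card_range, nsmul_eq_mul]
      have : (τ : ℝ) ≤ E := by exact_mod_cast hτ.le
      calc (τ : ℝ) * (4 * (η * L) * ‖g i wk‖) ^ 2 ≤ E * (4 * (η * L) * ‖g i wk‖) ^ 2 := by gcongr
        _ = _ := by ring
  -- drift
  have hpt : ∀ τ, τ < E → ∀ ω,
      ∑ i, ‖g i (w i τ ω) - g i ((n : ℝ)⁻¹ • ∑ j, w j τ ω)‖ ^ 2
        ≤ 4 * E ^ 2 * (η * L) ^ 2 * ∑ i, ‖g i wk‖ ^ 2 := by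
    intro τ hτ ω
    calc _ ≤ ∑ i, L ^ 2 * ‖w i τ ω - (n : ℝ)⁻¹ • ∑ j, w j τ ω‖ ^ 2 := by
          apply Finset.sum_le_sum
          intro i _
          rw [← mul_pow]
          exact pow_le_pow_left₀ (norm_nonneg _) (hsmooth i _ _) 2
      _ = L ^ 2 * ∑ i, ‖w i τ ω - (n : ℝ)⁻¹ • ∑ j, w j τ ω‖ ^ 2 := by rw [Finset.mul_sum]
      _ ≤ L ^ 2 * ∑ i, ‖w i τ ω - wk‖ ^ 2 := by
          exact mul_le_mul_of_nonneg_left (aux_mean n hn (fun i => w i τ ω) wk) (by positivity)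
      _ ≤ L ^ 2 * ∑ i, (E * (2 * η * ‖g i wk‖)) ^ 2 := by
          gcongr with i _
          refine (hwb i τ hτ.le ω).trans ?_
          gcongr
      _ = _ := by
          rw [Finset.mul_sum, Finset.mul_sum]
          apply Finset.sum_congr rfl
          intro i _
          ring
  have hbarm : ∀ τ, τ < E → Measurable fun ω => (n : ℝ)⁻¹ • ∑ j, w j τ ω := by
    intro τ hτ
    have h1 : Measurable fun ω => ∑ j, w j τ ω :=
      Finset.measurable_sum _ fun j _ => (hmeas j τ hτ).1
    exact h1.const_smul (n : ℝ)⁻¹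
  have hem : ∀ τ, τ < E → ∀ i, Measurable fun ω =>
      g i (w i τ ω) - g i ((n : ℝ)⁻¹ • ∑ j, w j τ ω) := by
    intro τ hτ i
    exact ((hgm i).comp (hmeas i τ hτ).1).sub ((hgm i).comp (hbarm τ hτ))
  have hei : ∀ τ, τ < E → ∀ i, Integrable (fun ω =>
      ‖g i (w i τ ω) - g i ((n : ℝ)⁻¹ • ∑ j, w j τ ω)‖ ^ 2) P := by
    intro τ hτ i
    refine Integrable.of_bound ((hem τ hτ i).norm.pow_const 2).aestronglyMeasurable
      (4 * E ^ 2 * (η * L) ^ 2 * ∑ i, ‖g i wk‖ ^ 2) (.of_forall fun ω => ?_)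
    rw [Real.norm_of_nonneg (by positivity)]
    refine le_trans ?_ (hpt τ hτ ω)
    exact Finset.single_le_sum
      (f := fun i => ‖g i (w i τ ω) - g i ((n : ℝ)⁻¹ • ∑ j, w j τ ω)‖ ^ 2)
      (fun _ _ => by positivity) (Finset.mem_univ i)
  have hdrift : ∀ τ, τ < E →
      ∫ ω, ‖∑ i, (g i (w i τ ω) - g i ((n : ℝ)⁻¹ • ∑ j, w j τ ω))‖ ^ 2 ∂P
        ≤ α * (4 * E ^ 2 * (η * L) ^ 2 * ∑ i, ‖g i wk‖ ^ 2) := by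
    intro τ hτ
    rcases Nat.eq_zero_or_pos τ with h0 | h0
    · subst h0
      have hn0 : (n : ℝ) ≠ 0 := by positivity
      have : ∀ ω, (n : ℝ)⁻¹ • ∑ j, w j 0 ω = wk := by
        intro ω
        simp only [hw0]
        rw [Finset.sum_const, Finset.card_univ, Fintype.card_fin,
          ← Nat.cast_smul_eq_nsmul ℝ, smul_smul, inv_mul_cancel₀ hn0, one_smul]
      simp_rw [this, hw0]
      simp
      positivity
    · refine (hhet τ h0 hτ.le).trans ?_
      gcongr
      rw [← integral_finsetSum _ (fun i _ => hei τ hτ i)]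
      calc _ ≤ ∫ ω, (4 * E ^ 2 * (η * L) ^ 2 * ∑ i, ‖g i wk‖ ^ 2) ∂P :=
            integral_mono (integrable_finsetSum _ (fun i _ => hei τ hτ i)) (integrable_const _)
              (hpt τ hτ)
        _ = _ := by simp
  -- bounded integrands
  have hAi : ∀ τ, τ < E → Integrable (fun ω => ‖∑ i, (v i τ ω - g i (w i τ ω))‖ ^ 2) P := by
    intro τ hτ
    refine Integrable.of_bound ((Finset.measurable_sum _ fun i _ => (hmeas i τ hτ).2.sub
      ((hgm i).comp (hmeas i τ hτ).1)).norm.pow_const 2).aestronglyMeasurable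
      ((∑ i, (2 * ‖g i wk‖ + (‖g i wk‖ + L * (τ * (2 * η * ‖g i wk‖))))) ^ 2)
      (.of_forall fun ω => ?_)
    rw [Real.norm_of_nonneg (by positivity)]
    apply pow_le_pow_left₀ (norm_nonneg _)
    refine (norm_sum_le _ _).trans (Finset.sum_le_sum fun i _ => ?_)
    refine (norm_sub_le _ _).trans (add_le_add (hvb i τ hτ ω) ?_)
    have h1 := hsmooth i (w i τ ω) wk
    have h2 : L * ‖w i τ ω - wk‖ ≤ L * (τ * (2 * η * ‖g i wk‖)) := by
      gcongr; exact hwb i τ hτ.le ω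
    have h3 := norm_le_norm_add_norm_sub' (g i (w i τ ω)) (g i wk)
    linarith
  have hBi : ∀ τ, τ < E → Integrable (fun ω =>
      ‖∑ i, (g i (w i τ ω) - g i ((n : ℝ)⁻¹ • ∑ j, w j τ ω))‖ ^ 2) P := by
    intro τ hτ
    refine Integrable.mono' (((integrable_finsetSum univ (fun i _ => hei τ hτ i))).const_mul (n : ℝ))
      ((Finset.measurable_sum _ fun i _ => hem τ hτ i).norm.pow_const 2).aestronglyMeasurable
      (.of_forall fun ω => ?_)
    rw [Real.norm_of_nonneg (by positivity)]
    refine (pow_le_pow_left₀ (norm_nonneg _) (norm_sum_le _ _) 2).trans ?_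
    have := sq_sum_le_card_mul_sum_sq (s := (univ : Finset (Fin n)))
      (f := fun i => ‖g i (w i τ ω) - g i ((n : ℝ)⁻¹ • ∑ j, w j τ ω)‖)
    simpa using this
  have hfin : ∀ τ, τ < E →
      ∫ ω, ‖(n : ℝ)⁻¹ • ∑ i, v i τ ω
            - (n : ℝ)⁻¹ • ∑ i, g i ((n : ℝ)⁻¹ • ∑ i, w i τ ω)‖ ^ 2 ∂P
      ≤ 2 * ((n : ℝ)⁻¹) ^ 2 * (16 * E * (η * L) ^ 2 * ∑ i, ‖g i wk‖ ^ 2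
        + α * (4 * E ^ 2 * (η * L) ^ 2 * ∑ i, ‖g i wk‖ ^ 2)) := by
    intro τ hτ
    calc _ ≤ ∫ ω, 2 * ((n : ℝ)⁻¹) ^ 2 * (‖∑ i, (v i τ ω - g i (w i τ ω))‖ ^ 2
          + ‖∑ i, (g i (w i τ ω) - g i ((n : ℝ)⁻¹ • ∑ j, w j τ ω))‖ ^ 2) ∂P := by
          apply integral_mono_of_nonneg (.of_forall fun ω => by positivity)
            (((hAi τ hτ).add (hBi τ hτ)).const_mul _)
          refine .of_forall fun ω => ?_
          have e : (n : ℝ)⁻¹ • ∑ i, v i τ ω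
              - (n : ℝ)⁻¹ • ∑ i, g i ((n : ℝ)⁻¹ • ∑ i, w i τ ω)
              = (n : ℝ)⁻¹ • (∑ i, (v i τ ω - g i (w i τ ω))
                + ∑ i, (g i (w i τ ω) - g i ((n : ℝ)⁻¹ • ∑ j, w j τ ω))) := by
            rw [← smul_sub, ← Finset.sum_add_distrib, ← Finset.sum_sub_distrib]
            congr 1
            apply Finset.sum_congr rfl
            intro i _
            abel
          change ‖(n : ℝ)⁻¹ • ∑ i, v i τ ω
              - (n : ℝ)⁻¹ • ∑ i, g i ((n : ℝ)⁻¹ • ∑ i, w i τ ω)‖ ^ 2 ≤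
            2 * ((n : ℝ)⁻¹) ^ 2 * (‖∑ i, (v i τ ω - g i (w i τ ω))‖ ^ 2
              + ‖∑ i, (g i (w i τ ω) - g i ((n : ℝ)⁻¹ • ∑ j, w j τ ω))‖ ^ 2)
          rw [e, norm_smul, mul_pow, Real.norm_of_nonneg (by positivity : (0:ℝ) ≤ (n : ℝ)⁻¹)]
          set A := ∑ i, (v i τ ω - g i (w i τ ω))
          set B := ∑ i, (g i (w i τ ω) - g i ((n : ℝ)⁻¹ • ∑ j, w j τ ω))
          have h1 : ‖A + B‖ ^ 2 ≤ 2 * (‖A‖ ^ 2 + ‖B‖ ^ 2) := by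
            have := pow_le_pow_left₀ (norm_nonneg _) (norm_add_le A B) 2
            nlinarith [sq_nonneg (‖A‖ - ‖B‖)]
          calc _ ≤ ((n : ℝ)⁻¹) ^ 2 * (2 * (‖A‖ ^ 2 + ‖B‖ ^ 2)) := by gcongr
            _ = _ := by ring
      _ = 2 * ((n : ℝ)⁻¹) ^ 2 * (∫ ω, ‖∑ i, (v i τ ω - g i (w i τ ω))‖ ^ 2 ∂P
          + ∫ ω, ‖∑ i, (g i (w i τ ω) - g i ((n : ℝ)⁻¹ • ∑ j, w j τ ω))‖ ^ 2 ∂P) := by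
          rw [integral_const_mul, integral_add (hAi τ hτ) (hBi τ hτ)]
      _ ≤ _ := by
          gcongr
          · exact hmart τ hτ
          · exact hdrift τ hτ
  refine (Finset.sum_le_sum fun τ hτ => hfin τ (Finset.mem_range.1 hτ)).trans ?_
  rw [Finset.sum_const, Finset.card_range, nsmul_eq_mul]
  have hS : 0 ≤ ∑ i, ‖g i wk‖ ^ 2 := by positivity
  set S := ∑ i, ‖g i wk‖ ^ 2
  have hdiff : (16 * η ^ 2 * L ^ 2 * (E : ℝ) ^ 2 * (α * E + 4) / (n : ℝ) ^ 2) * S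
      - (E : ℝ) * (2 * ((n : ℝ)⁻¹) ^ 2 * (16 * E * (η * L) ^ 2 * S
        + α * (4 * E ^ 2 * (η * L) ^ 2 * S)))
      = ((n : ℝ)⁻¹) ^ 2 * (η * L) ^ 2 * S * E ^ 2 * (8 * α * E + 32) := by
    field_simp
    ring
  have : 0 ≤ ((n : ℝ)⁻¹) ^ 2 * (η * L) ^ 2 * S * E ^ 2 * (8 * α * E + 32) := by positivity
  linarith

/-- Modify the batches on a null set so that all stochastic gradients become measurable. -/
lemma aux_modify {d : ℕ} {Bt : Type*} [MeasurableSpace Bt]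
    (μB : Measure Bt) [IsProbabilityMeasure μB] (n : ℕ) (L : ℝ) (hL : 0 < L)
    (G : Fin n → EuclideanSpace ℝ (Fin d) → Bt → EuclideanSpace ℝ (Fin d))
    (hGlip : ∀ i b x y, ‖G i x b - G i y b‖ ≤ L * ‖x - y‖)
    (hGint : ∀ i x, Integrable (G i x) μB) :
    ∃ φ : Bt → Bt, (∀ᵐ b ∂μB, φ b = b) ∧ ∀ i x, Measurable fun b => G i x (φ b) := by
  classical
  let D := TopologicalSpace.denseSeq (EuclideanSpace ℝ (Fin d))
  have hD : DenseRange D := TopologicalSpace.denseRange_denseSeq _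
  have hae : ∀ᵐ b ∂μB, ∀ i, ∀ m : ℕ, G i (D m) b = (hGint i (D m)).1.mk _ b := by
    rw [ae_all_iff]; intro i
    rw [ae_all_iff]; intro m
    exact (hGint i (D m)).1.ae_eq_mk
  obtain ⟨N, hsub, hNm, hN0⟩ := exists_measurable_superset_of_null (ae_iff.1 hae)
  have hgood : ∀ b, b ∉ N → ∀ i, ∀ m : ℕ, G i (D m) b = (hGint i (D m)).1.mk _ b := by
    intro b hb
    by_contra hcon
    exact hb (hsub hcon)
  have hNae : ∀ᵐ b ∂μB, b ∉ N := measure_eq_zero_iff_ae_notMem.1 hN0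
  obtain ⟨b0, hb0⟩ := hNae.exists
  refine ⟨fun b => if b ∈ N then b0 else b, ?_, ?_⟩
  · filter_upwards [hNae] with b hb
    simp [hb]
  · intro i x
    have hDm : ∀ m, Measurable fun b => G i (D m) (if b ∈ N then b0 else b) := by
      intro m
      have : (fun b => G i (D m) (if b ∈ N then b0 else b))
          = fun b => if b ∈ N then G i (D m) b0 else (hGint i (D m)).1.mk _ b := by
        ext1 b
        by_cases hb : b ∈ N
        · simp [hb]
        · simp only [hb, if_false]
          exact hgood b hb i m
      rw [this]
      exact Measurable.ite hNm measurable_const (hGint i (D m)).1.stronglyMeasurable_mk.measurable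
    have hx : x ∈ closure (Set.range D) := hD x
    obtain ⟨u, hu, hlim⟩ := mem_closure_iff_seq_limit.1 hx
    choose m hm using hu
    refine measurable_of_tendsto_metrizable (f := fun k b => G i (D (m k)) (if b ∈ N then b0 else b))
      (fun k => hDm (m k)) ?_
    rw [tendsto_pi_nhds]
    intro b
    have hc : Continuous fun y => G i y (if b ∈ N then b0 else b) := by
      apply LipschitzWith.continuous (K := ⟨L, hL.le⟩)
      apply LipschitzWith.of_dist_le_mul
      intro x y
      rw [dist_eq_norm, dist_eq_norm]
      exact hGlip i _ x y
    have := (hc.tendsto x).comp hlim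
    refine this.congr fun k => ?_
    simp [hm]

/-- Lemma "fl-lem2".
Multi-client local-momentum setup: `n` clients with `L`-smooth objectives `f i`,
`f = (1/n)Σᵢ fᵢ`, unbiased `L`-Lipschitz stochastic gradients `G i · b`; in round `k`
every client runs the SPIDER-style local-momentum recursion from `wk = w_k` on its own
i.i.d. batches (the coordinates of the product probability space `Fin n → Fin E → Bt`).
Under the heterogeneity assumption with constant `α ≤ n`, if `η < 1/L` and
`E < (1/4)·min(1/(ηL), 1/(η²L²) − 1/(ηL))`, then
`Σ_{τ=0}^{E−1} E[‖v̄_{k,τ} − ∇f(w̄_{k,τ})‖²] ≤ (16η²L²E²(αE+4)/n²)·Σᵢ ‖∇fᵢ(w_k)‖²`. -/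
theorem stmt5
    {d : ℕ} {Bt : Type*} [MeasurableSpace Bt]
    (μB : Measure Bt) [IsProbabilityMeasure μB]
    (n E : ℕ) (hn : 1 ≤ n) (hE : 1 ≤ E) (η L α : ℝ)
    (hη : 0 < η) (hL : 0 < L) (hα : 0 ≤ α) (hαn : α ≤ n)
    (f : Fin n → EuclideanSpace ℝ (Fin d) → ℝ)
    (hdiff : ∀ i, Differentiable ℝ (f i))
    (hsmooth : ∀ i x y, ‖gradient (f i) x - gradient (f i) y‖ ≤ L * ‖x - y‖)
    (G : Fin n → EuclideanSpace ℝ (Fin d) → Bt → EuclideanSpace ℝ (Fin d))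
    (hGlip : ∀ i b x y, ‖G i x b - G i y b‖ ≤ L * ‖x - y‖)
    (hGint : ∀ i x, Integrable (G i x) μB)
    (hGunb : ∀ i x, ∫ b, G i x b ∂μB = gradient (f i) x)
    (wk : EuclideanSpace ℝ (Fin d))
    (w v : Fin n → ℕ → (Fin n → Fin E → Bt) → EuclideanSpace ℝ (Fin d))
    (hw0 : ∀ i ω, w i 0 ω = wk)
    (hv0 : ∀ i ω, v i 0 ω = gradient (f i) wk)
    (hv : ∀ i τ (h1 : 1 ≤ τ) (h2 : τ < E), ∀ ω,
      v i τ ω = G i (w i τ ω) (ω i ⟨τ, h2⟩) + v i (τ - 1) ω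
        - G i (w i (τ - 1) ω) (ω i ⟨τ, h2⟩))
    (hw : ∀ i τ, τ < E → ∀ ω, w i (τ + 1) ω = w i τ ω - η • v i τ ω)
    (hhet : ∀ τ, 1 ≤ τ → τ ≤ E →
      ∫ ω, ‖∑ i, (gradient (f i) (w i τ ω)
          - gradient (f i) ((n : ℝ)⁻¹ • ∑ j, w j τ ω))‖ ^ 2
          ∂(Measure.pi fun _ : Fin n => Measure.pi fun _ : Fin E => μB)
        ≤ α * ∑ i, ∫ ω, ‖gradient (f i) (w i τ ω)
          - gradient (f i) ((n : ℝ)⁻¹ • ∑ j, w j τ ω)‖ ^ 2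
          ∂(Measure.pi fun _ : Fin n => Measure.pi fun _ : Fin E => μB))
    (hηL : η < 1 / L)
    (hEcond : (E : ℝ) < (1 / 4) * min (1 / (η * L)) (1 / (η ^ 2 * L ^ 2) - 1 / (η * L))) :
    ∑ τ ∈ Finset.range E,
        ∫ ω, ‖(n : ℝ)⁻¹ • ∑ i, v i τ ω
            - gradient (fun x => (n : ℝ)⁻¹ * ∑ i, f i x) ((n : ℝ)⁻¹ • ∑ i, w i τ ω)‖ ^ 2
          ∂(Measure.pi fun _ : Fin n => Measure.pi fun _ : Fin E => μB)
      ≤ (16 * η ^ 2 * L ^ 2 * (E : ℝ) ^ 2 * (α * E + 4) / (n : ℝ) ^ 2) *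
          ∑ i, ‖gradient (f i) wk‖ ^ 2 := by
  classical
  obtain ⟨φ, hφ, hφm⟩ := aux_modify μB n L hL G hGlip hGint
  have hgrad : ∀ x, gradient (fun x => (n : ℝ)⁻¹ * ∑ i, f i x) x
      = (n : ℝ)⁻¹ • ∑ i, gradient (f i) x := by
    intro x
    have h1 : HasFDerivAt (fun x => (n : ℝ)⁻¹ * ∑ i, f i x)
        ((n : ℝ)⁻¹ • ∑ i, fderiv ℝ (f i) x) x :=
      (HasFDerivAt.fun_sum (fun i _ => ((hdiff i) x).hasFDerivAt)).const_mul _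
    simp only [gradient]
    rw [h1.fderiv, map_smul, map_sum]
  simp_rw [hgrad]
  have hE4 : (E : ℝ) * (η * L) ≤ 1 / 4 := by
    have hp : 0 < η * L := by positivity
    have h1 : (E : ℝ) < (1 / 4) * (1 / (η * L)) :=
      hEcond.trans_le (mul_le_mul_of_nonneg_left (min_le_left _ _) (by norm_num))
    have h2 := mul_lt_mul_of_pos_right h1 hp
    rw [mul_assoc, one_div_mul_cancel hp.ne'] at h2
    linarith
  let Φ : (Fin n → Fin E → Bt) → (Fin n → Fin E → Bt) := fun ω i t => φ (ω i t)
  have hΦ : ∀ᵐ ω ∂(Measure.pi fun _ : Fin n => Measure.pi fun _ : Fin E => μB), Φ ω = ω := by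
    have h1 : ∀ i : Fin n, ∀ t : Fin E,
        ∀ᵐ ω ∂(Measure.pi fun _ : Fin n => Measure.pi fun _ : Fin E => μB),
          φ (ω i t) = ω i t := by
      intro i t
      have a := (measurePreserving_eval (fun _ : Fin n => Measure.pi fun _ : Fin E => μB)
        i).quasiMeasurePreserving
      have b := (measurePreserving_eval (fun _ : Fin E => μB) t).quasiMeasurePreserving
      exact a.ae (b.ae hφ)
    have h2 := ae_all_iff.2 fun i => ae_all_iff.2 (h1 i)
    filter_upwards [h2] with ω hω
    ext i t
    exact hω i t
  have hint : ∀ F : (Fin n → Fin E → Bt) → ℝ,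
      ∫ ω, F (Φ ω) ∂(Measure.pi fun _ : Fin n => Measure.pi fun _ : Fin E => μB)
        = ∫ ω, F ω ∂(Measure.pi fun _ : Fin n => Measure.pi fun _ : Fin E => μB) := by
    intro F
    apply integral_congr_ae
    filter_upwards [hΦ] with ω hω
    rw [hω]
  have hGae : ∀ i x, (fun b => G i x (φ b)) =ᵐ[μB] G i x := by
    intro i x
    filter_upwards [hφ] with b hb
    rw [hb]
  have key := aux_core μB n E hn η L α hη hL hα (fun i => gradient (f i)) hsmooth
    (fun i x b => G i x (φ b)) (fun i b x y => hGlip i (φ b) x y)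
    (fun i x => (hGint i x).congr (hGae i x).symm) hφm
    (fun i x => (integral_congr_ae (hGae i x)).trans (hGunb i x)) wk
    (fun i τ ω => w i τ (Φ ω)) (fun i τ ω => v i τ (Φ ω))
    (fun i ω => hw0 i _) (fun i ω => hv0 i _)
    (fun i τ h2 ω => hv i (τ + 1) (by omega) h2 (Φ ω))
    (fun i τ h ω => hw i τ h _)
    (by
      intro τ h1 h2
      have h3 := hhet τ h1 h2
      rw [← hint] at h3
      refine h3.trans (le_of_eq ?_)
      congr 1
      apply Finset.sum_congr rfl
      intro i _
      rw [← hint])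
    hE4
  refine le_trans (le_of_eq ?_) key
  apply Finset.sum_congr rfl
  intro τ _
  rw [← hint]
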